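/- Let k be an algebraically closed field of characteristic 0. Index coordinates by the 10 pairs (i,j) with 1 ≤ i < j ≤ 5, and let C ⊆ k^{10} be the affine cone over the Grassmannian Gr(2,5) in its Plücker embedding, i.e., the set of tuples (x_{ij}) such that for every 4-element subset {i < j < l < m} of {1,2,3,4,5} the Plücker relation x_{ij}·x_{lm} − x_{il}·x_{jm} + x_{im}·x_{jl} = 0 holds. Let t = (t_{ij}) be a tuple of nonzero elements of k. Then the coordinatewise dilatation x ↦ (t_{ij}·x_{ij}) maps C into C if and only if there exist nonzero elements a₁, a₂, a₃, a₄, a₅ of k such that t_{ij} = a_i·a_j for all i < j; in that case the dilatation maps C onto C. -/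

import Mathlib

/-- `x : Fin 5 → Fin 5 → k` (its values at strictly increasing pairs of indices being
the Plücker coordinates `x_{ij}`, `i < j`) lies on the affine cone over `Gr(2,5)` if the
Plücker relation holds for every 4-element subset `{i < j < l < m}` of `{1,…,5}`. -/
def PluckerCone {k : Type*} [Field k] (x : Fin 5 → Fin 5 → k) : Prop :=
  ∀ i j l m : Fin 5, i < j → j < l → l < m →
    x i j * x l m - x i l * x j m + x i m * x j l = 0

theorem plucker_of_vectors {k : Type*} [Field k] (u v : Fin 5 → k) :
    PluckerCone (fun i j => u i * v j - u j * v i) := by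
  intro i j l m _ _ _
  ring

theorem dilat_rel {k : Type*} [Field k] (t : Fin 5 → Fin 5 → k)
    (H : ∀ x : Fin 5 → Fin 5 → k, PluckerCone x → PluckerCone (fun i j => t i j * x i j))
    (i j l m : Fin 5) (hij : i < j) (hjl : j < l) (hlm : l < m) :
    t i j * t l m = t i l * t j m ∧ t i l * t j m = t i m * t j l := by
  have h1 := H _ (plucker_of_vectors (fun n => if n = i ∨ n = m then (1 : k) else 0)
    (fun n => if n = i then (0 : k) else 1)) i j l m hij hjl hlm
  have h2 := H _ (plucker_of_vectors (fun n => if n = l then (0 : k) else 1)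
    (fun n => if n = l ∨ n = m then (1 : k) else 0)) i j l m hij hjl hlm
  have hil := hij.trans hjl
  have hjm := hjl.trans hlm
  have him := hij.trans hjm
  simp [hij.ne, hij.ne', hjl.ne, hjl.ne', hlm.ne, hlm.ne', hil.ne, hil.ne', hjm.ne, hjm.ne',
    him.ne, him.ne'] at h1 h2
  constructor
  · linear_combination -h1
  · linear_combination -h2

/-- The only dilatations (coordinatewise multiplications by nonzero scalars `t_{ij}`)
mapping the affine cone over `Gr(2,5)` in its Plücker embedding into itself are those
with `t_{ij} = a_i · a_j` for nonzero scalars `a₁, …, a₅`; and such a dilatation maps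
the cone onto itself. -/
theorem grassmannian_cone_dilatation
    (k : Type*) [Field k] [IsAlgClosed k] [CharZero k]
    (t : Fin 5 → Fin 5 → k) (ht : ∀ i j : Fin 5, i < j → t i j ≠ 0) :
    ((∀ x : Fin 5 → Fin 5 → k, PluckerCone x →
        PluckerCone (fun i j => t i j * x i j)) ↔
      (∃ a : Fin 5 → k, (∀ i, a i ≠ 0) ∧ ∀ i j : Fin 5, i < j → t i j = a i * a j))
    ∧ ((∃ a : Fin 5 → k, (∀ i, a i ≠ 0) ∧ ∀ i j : Fin 5, i < j → t i j = a i * a j) →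
        ∀ y : Fin 5 → Fin 5 → k, PluckerCone y →
          ∃ x : Fin 5 → Fin 5 → k, PluckerCone x ∧
            ∀ i j : Fin 5, i < j → t i j * x i j = y i j) := by
  refine ⟨⟨fun H => ?_, ?_⟩, ?_⟩
  · have n01 := ht 0 1 (by decide)
    have n02 := ht 0 2 (by decide)
    have n03 := ht 0 3 (by decide)
    have n04 := ht 0 4 (by decide)
    have n12 := ht 1 2 (by decide)
    obtain ⟨b, hb⟩ := IsAlgClosed.exists_pow_nat_eq (t 0 1 * t 0 2 / t 1 2) (n := 2) (by norm_num)
    have hb0 : b ≠ 0 := by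
      rintro rfl
      have : t 0 1 * t 0 2 / t 1 2 ≠ 0 := div_ne_zero (mul_ne_zero n01 n02) n12
      exact this (by rw [← hb]; ring)
    have hb2 : b ^ 2 * t 1 2 = t 0 1 * t 0 2 := by rw [hb]; field_simp
    obtain ⟨e1, e2⟩ := dilat_rel t H 0 1 2 3 (by decide) (by decide) (by decide)
    obtain ⟨e3, e4⟩ := dilat_rel t H 0 1 2 4 (by decide) (by decide) (by decide)
    obtain ⟨e5, e6⟩ := dilat_rel t H 0 1 3 4 (by decide) (by decide) (by decide)
    have key : ∀ p q r : k, r * (t 0 1 * t 0 2) = p * q * t 1 2 → r = p / b * (q / b) := by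
      intro p q r h
      field_simp
      apply mul_right_cancel₀ n12
      linear_combination h + r * hb2
    refine ⟨![b, t 0 1 / b, t 0 2 / b, t 0 3 / b, t 0 4 / b], ?_, ?_⟩
    · intro i
      fin_cases i <;> simp [*]
    · have k12 := key (t 0 1) (t 0 2) (t 1 2) (by ring)
      have k13 := key (t 0 1) (t 0 3) (t 1 3) (by linear_combination t 0 1 * e2)
      have k14 := key (t 0 1) (t 0 4) (t 1 4) (by linear_combination t 0 1 * e4)
      have k23 := key (t 0 2) (t 0 3) (t 2 3) (by linear_combination t 0 2 * (e1 + e2))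
      have k24 := key (t 0 2) (t 0 4) (t 2 4) (by linear_combination t 0 2 * (e3 + e4))
      have k34 := key (t 0 3) (t 0 4) (t 3 4)
        (by linear_combination t 0 2 * e5 + t 0 3 * e4)
      have k0 : ∀ p : k, p = b * (p / b) := fun p => by field_simp
      intro i j hij
      fin_cases i <;> fin_cases j <;>
        first
        | exact absurd hij (by decide)
        | exact k0 _
        | assumption
  · rintro ⟨a, ha, h⟩ x hx i j l m hij hjl hlm
    have hil := hij.trans hjl
    have hjm := hjl.trans hlm
    have him := hij.trans hjm
    simp only [h _ _ hij, h _ _ hjl, h _ _ hlm, h _ _ hil, h _ _ hjm, h _ _ him]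
    linear_combination a i * a j * a l * a m * hx i j l m hij hjl hlm
  · rintro ⟨a, ha, h⟩ y hy
    refine ⟨fun i j => (a i)⁻¹ * (a j)⁻¹ * y i j, ?_, ?_⟩
    · intro i j l m hij hjl hlm
      linear_combination (a i)⁻¹ * (a j)⁻¹ * (a l)⁻¹ * (a m)⁻¹ * hy i j l m hij hjl hlm
    · intro i j hij
      have := ha i
      have := ha j
      rw [h i j hij]
      field_simp
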